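/- arXiv:1706.05070 — 10 statements merged into one kernel-verified Lean document; each statement's English description precedes it below -/
import Mathlib

section
/- Let G₁ be an immediate descendant of G₂ (both representatives) and let F ∈ ℱ_∨ (i.e., F = ⋁S₀ for some S₀ ⊆ ℱ). If G₁ ⇒ F and F ⇒ G₂, then F = G₁ (pointwise) or F = G₂ (pointwise). -/
namespace Spex

variable {X : Type*}

/-- `F₁ ⇒ F₂`: `F₁` logically implies `F₂`. -/
def Imp (F₁ F₂ : X → Bool) : Prop := ∀ x, F₁ x = true → F₂ x = true

/-- The pointwise disjunction `⋁S` of a set of boolean functions, as a predicate on `X`. -/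
def DisjOn (S : Set (X → Bool)) (x : X) : Prop := ∃ f ∈ S, f x = true

/-- `S(P) = {f ∈ ℱ | f ⇒ P}` for a `Prop`-valued target `P`. -/
def SOfP (ℱ : Set (X → Bool)) (P : X → Prop) : Set (X → Bool) :=
  {f | f ∈ ℱ ∧ ∀ x, f x = true → P x}

/-- `S(G) = {f ∈ ℱ | f ⇒ G}`. -/
def SOf (ℱ : Set (X → Bool)) (G : X → Bool) : Set (X → Bool) :=
  SOfP ℱ (fun x => G x = true)

/-- `G` is a representative: `G = ⋁{f ∈ ℱ | f ⇒ G}` pointwise. -/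
def IsRep (ℱ : Set (X → Bool)) (G : X → Bool) : Prop :=
  ∀ x, G x = true ↔ DisjOn (SOf ℱ G) x

/-- A `Prop`-valued function is a representative: `P = ⋁{f ∈ ℱ | f ⇒ P}` pointwise. -/
def IsRepP (ℱ : Set (X → Bool)) (P : X → Prop) : Prop :=
  ∀ x, P x ↔ DisjOn (SOfP ℱ P) x

/-- `G₁` is a descendant of `G₂`. -/
def Desc (ℱ : Set (X → Bool)) (G₁ G₂ : X → Bool) : Prop :=
  IsRep ℱ G₁ ∧ IsRep ℱ G₂ ∧ Imp G₁ G₂ ∧ G₁ ≠ G₂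

/-- `G₁` is an immediate descendant of `G₂`. -/
def ImmDesc (ℱ : Set (X → Bool)) (G₁ G₂ : X → Bool) : Prop :=
  Desc ℱ G₁ G₂ ∧
    ¬ ∃ G : X → Bool, IsRep ℱ G ∧ Imp G₁ G ∧ Imp G G₂ ∧ G ≠ G₁ ∧ G ≠ G₂

/-- `Z(G,X') = {f ∈ S(G) | f(X') = 0}`. -/
def ZSet (ℱ : Set (X → Bool)) (G : X → Bool) (X' : Set X) : Set (X → Bool) :=
  {f | f ∈ SOf ℱ G ∧ ∀ x ∈ X', f x = false}

theorem isRep_of_forall_iff_disjOn {ℱ S : Set (X → Bool)} (hS : S ⊆ ℱ) {G : X → Bool}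
    (hG : ∀ x, G x = true ↔ DisjOn S x) : IsRep ℱ G := by
  intro x
  constructor
  · intro hx
    obtain ⟨f, hf, hfx⟩ := (hG x).1 hx
    exact ⟨f, ⟨hS hf, fun y hy => (hG y).2 ⟨f, hf, hy⟩⟩, hfx⟩
  · rintro ⟨f, hf, hfx⟩
    exact hf.2 x hfx

theorem stmt1 (ℱ : Set (X → Bool)) (hfin : ℱ.Finite) (G₁ G₂ : X → Bool)
    (himm : ImmDesc ℱ G₁ G₂)
    (S₀ : Set (X → Bool)) (hS₀ : S₀ ⊆ ℱ)
    (h1 : ∀ x, G₁ x = true → DisjOn S₀ x)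
    (h2 : ∀ x, DisjOn S₀ x → G₂ x = true) :
    (∀ x, DisjOn S₀ x ↔ G₁ x = true) ∨ (∀ x, DisjOn S₀ x ↔ G₂ x = true) := by
  classical
  let G : X → Bool := fun x => decide (DisjOn S₀ x)
  have hG : ∀ x, G x = true ↔ DisjOn S₀ x := fun x => decide_eq_true_iff
  by_contra! h
  refine himm.2 ⟨G, isRep_of_forall_iff_disjOn hS₀ hG, fun x hx => (hG x).2 (h1 x hx),
    fun x hx => h2 x ((hG x).1 hx), fun hEq => ?_, fun hEq => ?_⟩
  · obtain ⟨x, hx⟩ := h.1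
    have := hG x
    rw [hEq] at this
    tauto
  · obtain ⟨x, hx⟩ := h.2
    have := hG x
    rw [hEq] at this
    tauto

end Spex
end

section
/- If G₁ and G₂ are two distinct immediate descendants of a representative G, then G₁ ∨ G₂ = G pointwise. -/
namespace Spex

variable {X : Type*}

theorem Imp.or_left (F₁ F₂ : X → Bool) : Imp F₁ (fun x => F₁ x || F₂ x) := by
  intro x hx
  simp [hx]

theorem Imp.or_right (F₁ F₂ : X → Bool) : Imp F₂ (fun x => F₁ x || F₂ x) := by
  intro x hx
  simp [hx]

theorem Imp.or {F₁ F₂ G : X → Bool} (h₁ : Imp F₁ G) (h₂ : Imp F₂ G) :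
    Imp (fun x => F₁ x || F₂ x) G := by
  intro x hx
  rcases Bool.or_eq_true_iff.mp hx with hx | hx
  · exact h₁ x hx
  · exact h₂ x hx

theorem DisjOn.mono_of_imp {ℱ : Set (X → Bool)} {F G : X → Bool} (h : Imp F G) {x : X}
    (hx : DisjOn (SOf ℱ F) x) : DisjOn (SOf ℱ G) x := by
  obtain ⟨f, ⟨hf, hfF⟩, hfx⟩ := hx
  exact ⟨f, ⟨hf, fun y hy => h y (hfF y hy)⟩, hfx⟩

/-- The disjunction of two representatives is a representative. -/
theorem IsRep.or {ℱ : Set (X → Bool)} {F₁ F₂ : X → Bool} (h₁ : IsRep ℱ F₁) (h₂ : IsRep ℱ F₂) :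
    IsRep ℱ (fun x => F₁ x || F₂ x) := by
  intro x
  constructor
  · intro hx
    rcases Bool.or_eq_true_iff.mp hx with hx | hx
    · exact ((h₁ x).mp hx).mono_of_imp (Imp.or_left F₁ F₂)
    · exact ((h₂ x).mp hx).mono_of_imp (Imp.or_right F₁ F₂)
  · rintro ⟨f, ⟨-, hf⟩, hfx⟩
    exact hf x hfx

/-- Only the two endpoints lie between an immediate descendant and its ancestor. -/
theorem ImmDesc.eq_or_eq {ℱ : Set (X → Bool)} {F G H : X → Bool} (h : ImmDesc ℱ F G)
    (hH : IsRep ℱ H) (hFH : Imp F H) (hHG : Imp H G) : H = F ∨ H = G := by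
  by_contra! hn
  exact h.2 ⟨H, hH, hFH, hHG, hn.1, hn.2⟩

theorem stmt3 (ℱ : Set (X → Bool)) (hfin : ℱ.Finite) (G G₁ G₂ : X → Bool)
    (h₁ : ImmDesc ℱ G₁ G) (h₂ : ImmDesc ℱ G₂ G) (hne : G₁ ≠ G₂) :
    ∀ x, (G₁ x = true ∨ G₂ x = true) ↔ G x = true := by
  have hrep := h₁.1.1.or h₂.1.1
  have himp := h₁.1.2.2.1.or h₂.1.2.2.1
  have hG : (fun x => G₁ x || G₂ x) = G := by
    rcases h₁.eq_or_eq hrep (Imp.or_left G₁ G₂) himp with e₁ | e₁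
    · rcases h₂.eq_or_eq hrep (Imp.or_right G₁ G₂) himp with e₂ | e₂
      · exact absurd (e₁.symm.trans e₂) hne
      · exact e₂
    · exact e₁
  intro x
  rw [← congrFun hG x, Bool.or_eq_true_iff]

end Spex
end

section
/- Let G₁ and G₂ be representatives. Then ⋁(S(G₁) ∩ S(G₂)) is a representative, it satisfies ⋁(S(G₁) ∩ S(G₂)) ⇒ G₁ and ⋁(S(G₁) ∩ S(G₂)) ⇒ G₂, and it is the greatest common descendant: every representative G with G ⇒ G₁ and G ⇒ G₂ satisfies G ⇒ ⋁(S(G₁) ∩ S(G₂)). In particular, S(⋁(S(G₁) ∩ S(G₂))) = S(G₁) ∩ S(G₂). -/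
namespace Spex

variable {X : Type*}

theorem stmt5 (ℱ : Set (X → Bool)) (hfin : ℱ.Finite) (G₁ G₂ : X → Bool)
    (h₁ : IsRep ℱ G₁) (h₂ : IsRep ℱ G₂) :
    IsRepP ℱ (DisjOn (SOf ℱ G₁ ∩ SOf ℱ G₂)) ∧
    (∀ x, DisjOn (SOf ℱ G₁ ∩ SOf ℱ G₂) x → G₁ x = true) ∧
    (∀ x, DisjOn (SOf ℱ G₁ ∩ SOf ℱ G₂) x → G₂ x = true) ∧
    (∀ G : X → Bool, IsRep ℱ G → Imp G G₁ → Imp G G₂ →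
      ∀ x, G x = true → DisjOn (SOf ℱ G₁ ∩ SOf ℱ G₂) x) ∧
    SOfP ℱ (DisjOn (SOf ℱ G₁ ∩ SOf ℱ G₂)) = SOf ℱ G₁ ∩ SOf ℱ G₂ := by
  have hS : SOfP ℱ (DisjOn (SOf ℱ G₁ ∩ SOf ℱ G₂)) = SOf ℱ G₁ ∩ SOf ℱ G₂ := by
    ext f
    constructor
    · rintro ⟨hf, hfG⟩
      refine ⟨⟨hf, fun x hx => ?_⟩, ⟨hf, fun x hx => ?_⟩⟩
      · obtain ⟨g, hg, hgx⟩ := hfG x hx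
        exact hg.1.2 x hgx
      · obtain ⟨g, hg, hgx⟩ := hfG x hx
        exact hg.2.2 x hgx
    · exact fun hf => ⟨hf.1.1, fun x hx => ⟨f, hf, hx⟩⟩
  refine ⟨fun x => by rw [hS], ?_, ?_, ?_, hS⟩
  · rintro x ⟨f, hf, hx⟩
    exact hf.1.2 x hx
  · rintro x ⟨f, hf, hx⟩
    exact hf.2.2 x hx
  · intro G hG hG₁ hG₂ x hx
    obtain ⟨f, ⟨hf, hfG⟩, hfx⟩ := (hG x).1 hx
    exact ⟨f, ⟨⟨hf, fun y hy => hG₁ y (hfG y hy)⟩, ⟨hf, fun y hy => hG₂ y (hfG y hy)⟩⟩, hfx⟩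

end Spex
end

section
/- If G₁ and G₂ are two distinct immediate ascendants of a representative G (i.e., G is an immediate descendant of both G₁ and G₂, and G₁ ≠ G₂), then S(G₁) ∩ S(G₂) = S(G). -/
namespace Spex

variable {X : Type*}

lemma IsRep.or_s6 {ℱ : Set (X → Bool)} {G f : X → Bool} (hG : IsRep ℱ G) (hf : f ∈ ℱ) :
    IsRep ℱ (fun x => G x || f x) := by
  intro x
  constructor
  · intro hx
    rcases (Bool.or_eq_true _ _).mp hx with hx | hx
    · obtain ⟨g, ⟨hg, hgG⟩, hgx⟩ := (hG x).mp hx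
      exact ⟨g, ⟨hg, fun y hy => by simp [hgG y hy]⟩, hgx⟩
    · exact ⟨f, ⟨hf, fun y hy => by simp [hy]⟩, hx⟩
  · rintro ⟨g, ⟨-, hg⟩, hgx⟩
    exact hg x hgx

lemma ImmDesc.or_eq {ℱ : Set (X → Bool)} {G G' f : X → Bool} (h : ImmDesc ℱ G G')
    (hf : f ∈ SOf ℱ G') (hfG : ¬ Imp f G) : (fun x => G x || f x) = G' := by
  obtain ⟨⟨hG, -, hGG', -⟩, hmin⟩ := h
  by_contra hne
  refine hmin ⟨_, hG.or_s6 hf.1, fun x hx => by simp [hx], fun x hx => ?_, fun heq => ?_, hne⟩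
  · rcases (Bool.or_eq_true _ _).mp hx with hx | hx
    · exact hGG' x hx
    · exact hf.2 x hx
  · exact hfG fun x hx => by simpa [hx] using (congrFun heq x).symm

theorem stmt6 (ℱ : Set (X → Bool)) (hfin : ℱ.Finite) (G G₁ G₂ : X → Bool)
    (h₁ : ImmDesc ℱ G G₁) (h₂ : ImmDesc ℱ G G₂) (hne : G₁ ≠ G₂) :
    SOf ℱ G₁ ∩ SOf ℱ G₂ = SOf ℱ G := by
  ext f
  constructor
  · rintro ⟨hf₁, hf₂⟩
    refine ⟨hf₁.1, ?_⟩
    by_contra hfG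
    exact hne ((h₁.or_eq hf₁ hfG).symm.trans (h₂.or_eq hf₂ hfG))
  · rintro ⟨hf, hfG⟩
    exact ⟨⟨hf, fun x hx => h₁.1.2.2.1 x (hfG x hx)⟩, ⟨hf, fun x hx => h₂.1.2.2.1 x (hfG x hx)⟩⟩

end Spex
end

section
/- Let G be a representative. (1) For every nonempty set X' ⊆ {x ∈ X | G x = true}, the function ⋁Z(G,X') is a representative and is a descendant of G (it implies G and is not equal to G). (2) For every immediate descendant G' of G, there exists a set X' ⊆ {x ∈ X | G x = true} such that ⋁Z(G,X') = G' pointwise. -/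
namespace Spex

variable {X : Type*}

theorem isRepP_disjOn_of_subset {ℱ S : Set (X → Bool)} (hS : S ⊆ ℱ) :
    IsRepP ℱ (DisjOn S) := fun _ =>
  ⟨fun ⟨f, hf, hfx⟩ => ⟨f, ⟨hS hf, fun _ hy => ⟨f, hf, hy⟩⟩, hfx⟩,
    fun ⟨_, hf, hfx⟩ => hf.2 _ hfx⟩

theorem ZSet_subset (ℱ : Set (X → Bool)) (G : X → Bool) (X' : Set X) : ZSet ℱ G X' ⊆ ℱ :=
  fun _ hf => hf.1.1

theorem apply_eq_true_of_disjOn_ZSet {ℱ : Set (X → Bool)} {G : X → Bool} {X' : Set X} {x : X} :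
    DisjOn (ZSet ℱ G X') x → G x = true :=
  fun ⟨_, hf, hfx⟩ => hf.1.2 x hfx

theorem not_disjOn_ZSet_of_mem {ℱ : Set (X → Bool)} {G : X → Bool} {X' : Set X} {x : X}
    (hx : x ∈ X') : ¬ DisjOn (ZSet ℱ G X') x :=
  fun ⟨_, hf, hfx⟩ => Bool.false_ne_true ((hf.2 x hx).symm.trans hfx)

/-- The functions in `S(G)` vanishing on `G ∖ G'` are exactly those implying `G'`. -/
theorem ZSet_sdiff_eq_SOf {ℱ : Set (X → Bool)} {G G' : X → Bool} (h : Imp G' G) :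
    ZSet ℱ G {x | G x = true ∧ G' x = false} = SOf ℱ G' := by
  ext f
  constructor
  · rintro ⟨⟨hf, hfG⟩, hz⟩
    refine ⟨hf, fun x hx => ?_⟩
    by_contra hG'
    exact Bool.false_ne_true
      ((hz x ⟨hfG x hx, Bool.eq_false_of_not_eq_true hG'⟩).symm.trans hx)
  · rintro ⟨hf, hfG'⟩
    refine ⟨⟨hf, fun x hx => h x (hfG' x hx)⟩, fun x hx => Bool.eq_false_of_not_eq_true ?_⟩
    exact fun hfx => Bool.false_ne_true (hx.2.symm.trans (hfG' x hfx))

theorem stmt12 (ℱ : Set (X → Bool)) (hfin : ℱ.Finite) (G : X → Bool)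
    (hG : IsRep ℱ G) :
    (∀ X' : Set X, X'.Nonempty → X' ⊆ {x | G x = true} →
      (IsRepP ℱ (DisjOn (ZSet ℱ G X')) ∧
       (∀ x, DisjOn (ZSet ℱ G X') x → G x = true) ∧
       ¬ (∀ x, DisjOn (ZSet ℱ G X') x ↔ G x = true))) ∧
    (∀ G' : X → Bool, ImmDesc ℱ G' G →
      ∃ X' : Set X, X' ⊆ {x | G x = true} ∧
        ∀ x, DisjOn (ZSet ℱ G X') x ↔ G' x = true) := by
  refine ⟨fun X' ⟨x, hx⟩ hX' => ⟨isRepP_disjOn_of_subset (ZSet_subset ℱ G X'),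
    fun _ => apply_eq_true_of_disjOn_ZSet,
    fun heq => not_disjOn_ZSet_of_mem hx ((heq x).2 (hX' hx))⟩, ?_⟩
  rintro G' ⟨⟨hG', -, himp, -⟩, -⟩
  refine ⟨{x | G x = true ∧ G' x = false}, fun _ hx => hx.1, fun x => ?_⟩
  rw [ZSet_sdiff_eq_SOf himp]
  exact (hG' x).symm

end Spex
end

section
/- Let G be a representative and let G₁, …, G_m be pairwise distinct immediate descendants of G. Then G has no immediate descendant other than G₁, …, G_m if and only if G is pointwise equal to the function x ↦ (∃ i ∈ {1,…,m}, ∀ f ∈ S(G) \ S(G_i), f x = true). Moreover, if this equality fails and a ∈ X is a counterexample to it, then ⋁Z(G,{a}) is a descendant of G but is neither equal to nor a descendant of any G_i for i = 1, …, m. -/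
namespace Spex

variable {X : Type*}

section

variable {ℱ : Set (X → Bool)} {G G₁ G₂ : X → Bool}

theorem imp_iff_le : Imp G₁ G₂ ↔ G₁ ≤ G₂ :=
  Iff.rfl

theorem IsRep.imp (h : IsRep ℱ G₁) (hS : SOf ℱ G₁ ⊆ SOf ℱ G₂) : Imp G₁ G₂ := by
  intro x hx
  obtain ⟨f, hf, hfx⟩ := (h x).1 hx
  exact (hS hf).2 x hfx

theorem Imp.antisymm (h₁ : Imp G₁ G₂) (h₂ : Imp G₂ G₁) : G₁ = G₂ :=
  le_antisymm (imp_iff_le.1 h₁) (imp_iff_le.1 h₂)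

theorem finite_setOf_isRep (hfin : ℱ.Finite) : {G | IsRep ℱ G}.Finite := by
  refine Set.Finite.of_finite_image (f := SOf ℱ) ?_ ?_
  · refine hfin.finite_subsets.subset ?_
    rintro _ ⟨G, -, rfl⟩ f hf
    exact hf.1
  · intro G₁ h₁ G₂ h₂ h
    exact (IsRep.imp h₁ h.subset).antisymm (IsRep.imp h₂ h.superset)

/-- Every descendant of `G` lies below an immediate descendant of `G`. -/
theorem Desc.exists_immDesc (hfin : ℱ.Finite) (h : Desc ℱ G₁ G) :
    ∃ G', ImmDesc ℱ G' G ∧ Imp G₁ G' := by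
  have hD : {H | Desc ℱ H G}.Finite := (finite_setOf_isRep hfin).subset fun _ hH => hH.1
  obtain ⟨G', hle, hmax⟩ := hD.exists_le_maximal h
  refine ⟨G', ⟨hmax.prop, ?_⟩, hle⟩
  rintro ⟨H, hH, h₁, h₂, hne₁, hne₂⟩
  exact hne₁ (Imp.antisymm (hmax.le_of_ge ⟨hH, h.2.1, h₂, hne₂⟩ h₁) h₁)

theorem Desc.exists_mem_sdiff (h : Desc ℱ G₁ G) : ∃ f, f ∈ SOf ℱ G \ SOf ℱ G₁ := by
  by_contra! hn
  refine h.2.2.2 (h.2.2.1.antisymm (h.2.1.imp fun f hf => ?_))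
  by_contra hf'
  exact hn f ⟨hf, hf'⟩

theorem exists_isRep_eq_disjOn {S : Set (X → Bool)} (hS : S ⊆ ℱ) :
    ∃ H, IsRep ℱ H ∧ ∀ x, H x = true ↔ DisjOn S x := by
  classical
  have hH : ∀ x, decide (DisjOn S x) = true ↔ DisjOn S x := fun x => decide_eq_true_iff
  refine ⟨fun x => decide (DisjOn S x), fun x => ⟨fun hx => ?_, ?_⟩, hH⟩
  · obtain ⟨f, hf, hfx⟩ := (hH x).1 hx
    exact ⟨f, ⟨hS hf, fun y hy => (hH y).2 ⟨f, hf, hy⟩⟩, hfx⟩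
  · rintro ⟨f, hf, hfx⟩
    exact hf.2 x hfx

theorem DisjOn.of_zSet {X' : Set X} {x : X} (h : DisjOn (ZSet ℱ G X') x) : G x = true := by
  obtain ⟨f, hf, hfx⟩ := h
  exact hf.1.2 x hfx

theorem not_disjOn_zSet_singleton (a : X) : ¬ DisjOn (ZSet ℱ G {a}) a := by
  rintro ⟨f, hf, hfa⟩
  simp [hf.2 a rfl] at hfa

theorem not_zSet_imp {a : X} {f : X → Bool} (hf : f ∈ SOf ℱ G \ SOf ℱ G₁) (hfa : f a ≠ true) :
    ¬ ∀ x, DisjOn (ZSet ℱ G {a}) x → G₁ x = true := by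
  intro h
  refine hf.2 ⟨hf.1.1, fun x hx => h x ⟨f, ⟨hf.1, ?_⟩, hx⟩⟩
  rintro _ rfl
  simpa using hfa

theorem counterexample_iff {ι : Type*} {Gs : ι → X → Bool} (hGs : ∀ i, Desc ℱ (Gs i) G) {a : X} :
    ¬ (G a = true ↔ ∃ i, ∀ f ∈ SOf ℱ G \ SOf ℱ (Gs i), f a = true) ↔
      G a = true ∧ ∀ i, ∃ f ∈ SOf ℱ G \ SOf ℱ (Gs i), f a ≠ true := by
  have himp : (∃ i, ∀ f ∈ SOf ℱ G \ SOf ℱ (Gs i), f a = true) → G a = true := by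
    rintro ⟨i, hi⟩
    obtain ⟨f, hf⟩ := (hGs i).exists_mem_sdiff
    exact hf.1.2 a (hi f hf)
  rw [show (G a = true ↔ _) ↔ (G a = true → _) from ⟨Iff.mp, fun h => ⟨h, himp⟩⟩]
  push Not
  rfl

end

theorem stmt13 (ℱ : Set (X → Bool)) (hfin : ℱ.Finite) (G : X → Bool)
    (hG : IsRep ℱ G)
    (m : ℕ) (Gs : Fin m → X → Bool) (hinj : Function.Injective Gs)
    (himm : ∀ i, ImmDesc ℱ (Gs i) G) :
    ((∀ G', ImmDesc ℱ G' G → ∃ i, G' = Gs i) ↔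
      (∀ x, G x = true ↔ ∃ i : Fin m, ∀ f ∈ SOf ℱ G \ SOf ℱ (Gs i), f x = true)) ∧
    (∀ a : X,
      ¬ (G a = true ↔ ∃ i : Fin m, ∀ f ∈ SOf ℱ G \ SOf ℱ (Gs i), f a = true) →
      ((∀ x, DisjOn (ZSet ℱ G {a}) x → G x = true) ∧
       ¬ (∀ x, DisjOn (ZSet ℱ G {a}) x ↔ G x = true) ∧
       (∀ i : Fin m,
         ¬ (∀ x, DisjOn (ZSet ℱ G {a}) x ↔ Gs i x = true) ∧
         ¬ ((∀ x, DisjOn (ZSet ℱ G {a}) x → Gs i x = true) ∧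
            ¬ (∀ x, DisjOn (ZSet ℱ G {a}) x ↔ Gs i x = true))))) := by
  have hdesc i := (himm i).1
  refine ⟨⟨fun hall a => ?_, fun heq G' hG' => ?_⟩, fun a ha => ?_⟩
  · by_contra ha
    obtain ⟨hGa, hf⟩ := (counterexample_iff hdesc).1 ha
    obtain ⟨H, hH, hHZ⟩ := exists_isRep_eq_disjOn (S := ZSet ℱ G {a}) fun f hf => hf.1.1
    have hHG : Desc ℱ H G := by
      refine ⟨hH, hG, fun x hx => ((hHZ x).1 hx).of_zSet, ?_⟩
      rintro rfl
      exact not_disjOn_zSet_singleton a ((hHZ a).1 hGa)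
    obtain ⟨G', hG', hHG'⟩ := hHG.exists_immDesc hfin
    obtain ⟨i, rfl⟩ := hall G' hG'
    obtain ⟨f, hfS, hfa⟩ := hf i
    exact not_zSet_imp hfS hfa fun x hx => hHG' x ((hHZ x).2 hx)
  · obtain ⟨⟨hrep, -, himp, hne⟩, hmax⟩ := hG'
    obtain ⟨a, hGa, hGa'⟩ : ∃ a, G a = true ∧ G' a ≠ true := by
      by_contra! h
      exact hne (himp.antisymm h)
    obtain ⟨i, hi⟩ := (heq a).1 hGa
    have hle : Imp G' (Gs i) := hrep.imp fun f hf => by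
      by_contra hfi
      exact hGa' (hf.2 a (hi f ⟨⟨hf.1, fun x hx => himp x (hf.2 x hx)⟩, hfi⟩))
    refine ⟨i, ?_⟩
    by_contra hne'
    exact hmax ⟨Gs i, (hdesc i).1, hle, (hdesc i).2.2.1, Ne.symm hne', (hdesc i).2.2.2⟩
  · obtain ⟨hGa, hf⟩ := (counterexample_iff hdesc).1 ha
    refine ⟨fun x hx => hx.of_zSet, fun h => not_disjOn_zSet_singleton a ((h a).2 hGa),
      fun i => ?_⟩
    obtain ⟨f, hfS, hfa⟩ := hf i
    have hnot := not_zSet_imp hfS hfa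
    exact ⟨fun h => hnot fun x => (h x).1, fun h => hnot h.1⟩

end Spex
end

section
/- Let d ≥ 1 and let ℱ be a finite set of halfspace functions on ℝ^d with |ℱ| ≥ 2, i.e., each f ∈ ℱ has the form f(x) = decide (a₁x₁ + ⋯ + a_dx_d ≥ b) for some reals a₁,…,a_d,b. Then the set of dual sign patterns { (fun f ↦ f x) : x ∈ ℝ^d } ⊆ (ℱ → Bool) has cardinality at most |ℱ|^(d+1). In particular, there exists a set C ⊆ ℝ^d of critical points for ℱ of size at most |ℱ|^(d+1): for every S ⊆ ℱ, if some x ∈ ℝ^d satisfies f x = true for all f ∈ S and f x = false for all f ∈ ℱ \ S, then some c ∈ C satisfies the same. -/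
/-- A halfspace of dimension `d`: a boolean function of the form
`x ↦ [a₁x₁ + ⋯ + a_dx_d ≥ b]`. -/
def IsHalfspace {d : ℕ} (f : (Fin d → ℝ) → Bool) : Prop :=
  ∃ (a : Fin d → ℝ) (b : ℝ), ∀ x, f x = decide (∑ i, a i * x i ≥ b)

open Finset in
/-- If the affine functions `x ↦ ∑ j, a i j * x j - b i` on `ℝ^d` realise every sign pattern, there
are at most `d` of them. -/
theorem card_le_of_forall_exists_sign_pattern {ι : Type*} [Fintype ι] {d : ℕ}
    (a : ι → Fin d → ℝ) (b : ι → ℝ)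
    (h : ∀ P : ι → Prop, ∃ x : Fin d → ℝ, ∀ i, ∑ j, a i j * x j ≥ b i ↔ P i) :
    Fintype.card ι ≤ d := by
  by_contra! hlt
  have hdep : ¬ LinearIndependent ℝ a := fun hli => by
    have := hli.fintype_card_le_finrank
    rw [Module.finrank_fin_fun] at this
    omega
  obtain ⟨g, hg, i₀, hi₀⟩ : ∃ g : ι → ℝ, ∑ i, g i • a i = 0 ∧ ∃ i, g i < 0 := by
    obtain ⟨g, hg, i, hi⟩ := Fintype.not_linearIndependent_iff.1 hdep
    rcases lt_or_gt_of_ne hi with hi | hi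
    · exact ⟨g, hg, i, hi⟩
    · exact ⟨-g, by simp [hg], i, by simpa using hi⟩
  have hconst (x : Fin d → ℝ) :
      ∑ i, g i * (∑ j, a i j * x j - b i) = -∑ i, g i * b i := by
    have hz : ∑ i, g i * ∑ j, a i j * x j = 0 := by
      simp_rw [mul_sum]
      rw [sum_comm]
      refine sum_eq_zero fun j _ => ?_
      have hj : ∑ i, g i * a i j = 0 := by simpa using congrFun hg j
      simp_rw [← mul_assoc]
      rw [← sum_mul, hj, zero_mul]
    simp_rw [mul_sub]
    rw [sum_sub_distrib, hz, zero_sub]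
  obtain ⟨x, hx⟩ := h fun i => 0 ≤ g i
  obtain ⟨y, hy⟩ := h fun i => g i < 0
  have hpos : 0 < ∑ i, g i * (∑ j, a i j * x j - b i) := by
    have key (i) (hi : g i < 0) : 0 < g i * (∑ j, a i j * x j - b i) := by
      have := (hx i).not.2 (not_le.2 hi)
      exact mul_pos_of_neg_of_neg hi (by linarith)
    refine sum_pos' (fun i _ => ?_) ⟨i₀, mem_univ _, key i₀ hi₀⟩
    rcases lt_or_ge (g i) 0 with hi | hi
    · exact (key i hi).le
    · exact mul_nonneg hi (sub_nonneg.2 ((hx i).2 hi))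
  have hneg : ∑ i, g i * (∑ j, a i j * y j - b i) ≤ 0 := by
    refine sum_nonpos fun i _ => ?_
    rcases lt_or_ge (g i) 0 with hi | hi
    · exact mul_nonpos_of_nonpos_of_nonneg hi.le (sub_nonneg.2 ((hy i).2 hi))
    · have := (hy i).not.2 (not_lt.2 hi)
      exact mul_nonpos_of_nonneg_of_nonpos hi (by linarith)
  rw [hconst] at hpos hneg
  exact hneg.not_gt hpos

open Finset in
theorem sum_Iic_choose_le_pow {n : ℕ} (hn : 2 ≤ n) (d : ℕ) :
    ∑ k ∈ Iic d, n.choose k ≤ n ^ (d + 1) := by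
  calc ∑ k ∈ Iic d, n.choose k ≤ ∑ k ∈ Iic d, n ^ k :=
        sum_le_sum fun k _ => Nat.choose_le_pow n k
    _ ≤ n ^ (d + 1) := (Nat.geomSum_lt hn fun k hk => Nat.lt_succ_of_le (mem_Iic.1 hk)).le

open Classical Finset in
/-- The dual sign patterns of a finite family of at least two halfspaces, as sets of halfspaces,
number at most `|ι| ^ (d + 1)`. -/
theorem card_halfspace_cells_le {ι : Type*} [Fintype ι] {d : ℕ} (f : ι → (Fin d → ℝ) → Bool)
    (hf : ∀ i, IsHalfspace (f i)) (hι : 2 ≤ Fintype.card ι) :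
    #{A : Finset ι | ∃ x, ∀ i, i ∈ A ↔ f i x = true} ≤ Fintype.card ι ^ (d + 1) := by
  set 𝒜 : Finset (Finset ι) := {A : Finset ι | ∃ x, ∀ i, i ∈ A ↔ f i x = true}
  choose a b hab using hf
  have hvc : 𝒜.vcDim ≤ d := by
    refine Finset.sup_le fun s hs => ?_
    rw [mem_shatterer] at hs
    rw [← Fintype.card_coe]
    refine card_le_of_forall_exists_sign_pattern (fun i : s => a i) (fun i => b i) fun P => ?_
    obtain ⟨u, hu, hsu⟩ := hs (filter_subset (fun i => ∃ h : i ∈ s, P ⟨i, h⟩) s)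
    obtain ⟨x, hx⟩ := (mem_filter.1 hu).2
    refine ⟨x, fun i => ?_⟩
    have h₁ := hx i
    rw [hab, decide_eq_true_iff] at h₁
    rw [← h₁]
    have h₂ := congrArg (i.1 ∈ ·) hsu
    simpa using h₂
  calc #𝒜 ≤ #𝒜.shatterer := card_le_card_shatterer 𝒜
    _ ≤ ∑ k ∈ Iic 𝒜.vcDim, (Fintype.card ι).choose k := card_shatterer_le_sum_vcDim
    _ ≤ ∑ k ∈ Iic d, (Fintype.card ι).choose k :=
        sum_le_sum_of_subset (Iic_subset_Iic.2 hvc)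
    _ ≤ _ := sum_Iic_choose_le_pow hι d

open Classical in
theorem stmt15 (d : ℕ) (hd : 1 ≤ d) (ℱ : Finset ((Fin d → ℝ) → Bool))
    (hcard : 2 ≤ ℱ.card) (hhalf : ∀ f ∈ ℱ, IsHalfspace f) :
    Set.ncard {p : {f // f ∈ ℱ} → Bool | ∃ x : Fin d → ℝ, ∀ f, p f = f.1 x}
        ≤ ℱ.card ^ (d + 1) ∧
    ∃ C : Finset (Fin d → ℝ), C.card ≤ ℱ.card ^ (d + 1) ∧
      ∀ S ⊆ ℱ,
        (∃ x : Fin d → ℝ, (∀ f ∈ S, f x = true) ∧ (∀ f ∈ ℱ \ S, f x = false)) →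
        ∃ c ∈ C, (∀ f ∈ S, f c = true) ∧ (∀ f ∈ ℱ \ S, f c = false) := by
  have hcells := card_halfspace_cells_le (fun f : {f // f ∈ ℱ} => f.1)
    (fun f => hhalf f.1 f.2) (by simpa using hcard)
  rw [Fintype.card_coe] at hcells
  set T := {p : {f // f ∈ ℱ} → Bool | ∃ x : Fin d → ℝ, ∀ f, p f = f.1 x}
  have hT : T.ncard ≤ ℱ.card ^ (d + 1) := by
    refine le_trans ?_ hcells
    rw [← Set.ncard_coe_finset]
    refine Set.ncard_le_ncard_of_injOn (fun p => Finset.univ.filter fun f => p f = true)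
      ?_ ?_ (Finset.finite_toSet _)
    · rintro p ⟨x, hx⟩
      simp only [Finset.coe_filter, Finset.mem_univ, true_and, Set.mem_ofPred_eq, Finset.mem_filter]
      exact ⟨x, fun f => by rw [hx]⟩
    · intro p _ q _ hpq
      funext f
      have := congrArg (f ∈ ·) hpq
      rw [Bool.eq_iff_iff]
      simpa using this
  refine ⟨hT, ?_⟩
  choose c hc using fun p : T => p.2
  refine ⟨Finset.univ.image c, ?_, ?_⟩
  · refine Finset.card_image_le.trans ?_
    rwa [Finset.card_univ, ← Nat.card_eq_fintype_card, Nat.card_coe_set_eq]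
  · rintro S hS ⟨x, hx₁, hx₂⟩
    let p : T := ⟨fun f => f.1 x, x, fun _ => rfl⟩
    refine ⟨c p, Finset.mem_image_of_mem c (Finset.mem_univ p), fun f hf => ?_, fun f hf => ?_⟩
    · exact (hc p ⟨f, hS hf⟩).symm.trans (hx₁ f hf)
    · exact (hc p ⟨f, (Finset.mem_sdiff.1 hf).1⟩).symm.trans (hx₂ f hf)
end

section
/- Let n be a natural number, J a finite acyclic subset of Fin n × Fin n, and i, j ∈ Fin n with i ≠ j. Then the implication (∀ a : Fin n → ℝ, (∀ (p,q) ∈ J, a p > a q) → a i > a j) holds if and only if there is a path from i to j in J, i.e., Relation.TransGen (fun p q ↦ (p,q) ∈ J) i j. -/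
open Classical in
/-- In a finite acyclic relation, if `j` is not reachable from `i`, then some real labelling
decreases strictly along the relation without decreasing from `i` to `j`. -/
theorem exists_decreasing_le_of_not_reflTransGen {α : Type*} [Fintype α] {r : α → α → Prop}
    (hr : ∀ x, ¬ Relation.TransGen r x x) {i j : α} (hij : ¬ Relation.ReflTransGen r i j) :
    ∃ a : α → ℝ, (∀ p q, r p q → a q < a p) ∧ a i ≤ a j := by
  let D (x : α) : Finset α := {y | Relation.TransGen r x y}
  let b (x : α) : ℕ := if Relation.ReflTransGen r x j then Fintype.card α else 0
  refine ⟨fun x ↦ ((D x).card + b x : ℕ), fun p q hpq ↦ ?_, ?_⟩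
  · have hD : (D q).card < (D p).card := by
      refine Finset.card_lt_card ((Finset.ssubset_iff_of_subset fun y hy ↦ ?_).2 ⟨q, ?_, ?_⟩)
      · simp only [D, Finset.mem_filter_univ] at hy ⊢
        exact .head hpq hy
      · simpa [D] using Relation.TransGen.single hpq
      · simpa [D] using hr q
    have hb : b q ≤ b p := by
      by_cases hq : Relation.ReflTransGen r q j
      · simp [b, hq, Relation.ReflTransGen.head hpq hq]
      · simp [b, hq]
    exact Nat.cast_lt.2 (add_lt_add_of_lt_of_le hD hb)
  · have hi : b i = 0 := if_neg hij
    have hj : b j = Fintype.card α := if_pos .refl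
    have hD := (D i).card_le_univ
    exact Nat.cast_le.2 (by omega)

theorem stmt17 (n : ℕ) (J : Finset (Fin n × Fin n))
    (hacyclic : ¬ ∃ i : Fin n, Relation.TransGen (fun p q : Fin n => (p, q) ∈ J) i i)
    (i j : Fin n) (hne : i ≠ j) :
    (∀ a : Fin n → ℝ, (∀ p ∈ J, a p.1 > a p.2) → a i > a j) ↔
      Relation.TransGen (fun p q : Fin n => (p, q) ∈ J) i j := by
  constructor
  · intro h
    by_contra hij
    obtain ⟨a, ha, hle⟩ := exists_decreasing_le_of_not_reflTransGen
      (not_exists.1 hacyclic) (i := i) (j := j) fun hrefl ↦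
        (Relation.reflTransGen_iff_eq_or_transGen.1 hrefl).elim (fun e ↦ hne e.symm) hij
    exact (h a fun p hp ↦ ha p.1 p.2 hp).not_ge hle
  · intro h a ha
    clear hne
    induction h with
    | single hp => exact ha _ hp
    | tail _ hp ih => exact (ha _ hp).trans ih
end

section
/- Let n be a natural number, let I be a finite acyclic subset of Fin n × Fin n, and let J₁, J₂ ⊆ I. Then F_{J₁} = F_{J₂} (i.e., for every a : Fin n → ℝ, a satisfies J₁ if and only if a satisfies J₂) if and only if the path relations of J₁ and J₂ coincide, i.e., for all i, j ∈ Fin n, Relation.TransGen (fun p q ↦ (p,q) ∈ J₁) i j ↔ Relation.TransGen (fun p q ↦ (p,q) ∈ J₂) i j. -/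
theorem lt_of_transGen {V : Type*} {r : V → V → Prop} {a : V → ℝ}
    (ha : ∀ p q, r p q → a q < a p) {i j : V} (h : Relation.TransGen r i j) : a j < a i := by
  induction h with
  | single h => exact ha _ _ h
  | tail _ h ih => exact (ha _ _ h).trans ih

open Classical in
/-- In a finite acyclic relation, the strict inequalities forced by the edges are exactly those
given by paths: the separating assignment counts descendants and adds a bonus to the ancestors
of `j`. -/
theorem transGen_of_forall_lt {V : Type*} [Fintype V] {r : V → V → Prop}
    (hr : ∀ i, ¬ Relation.TransGen r i i) {i j : V}
    (h : ∀ a : V → ℝ, (∀ p q, r p q → a q < a p) → a j < a i) : Relation.TransGen r i j := by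
  let D : V → Finset V := fun k => Finset.univ.filter (Relation.TransGen r k)
  let b : V → ℕ := fun k => if Relation.ReflTransGen r k j then Fintype.card V else 0
  have hlt := h (fun k => (((D k).card + b k : ℕ) : ℝ)) fun p q hpq => by
    have hD : (D q).card < (D p).card := by
      refine Finset.card_lt_card (Finset.ssubset_iff_of_subset ?_ |>.2 ⟨q, ?_, ?_⟩)
      · intro m hm
        simp only [D, Finset.mem_filter, Finset.mem_univ, true_and] at hm ⊢
        exact hm.head hpq
      · simpa [D] using Relation.TransGen.single hpq
      · simpa [D] using hr q
    have hb : b q ≤ b p := by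
      by_cases hq : Relation.ReflTransGen r q j
      · simp [b, hq, hq.head hpq]
      · simp [b, hq]
    exact_mod_cast add_lt_add_of_lt_of_le hD hb
  have hlt' : (D j).card + b j < (D i).card + b i := by exact_mod_cast hlt
  by_contra hij
  by_cases heq : i = j
  · subst heq
    exact lt_irrefl _ hlt'
  · have hi : ¬ Relation.ReflTransGen r i j := fun hp =>
      (Relation.reflTransGen_iff_eq_or_transGen.1 hp).elim (fun e => heq e.symm) hij
    have hbi : b i = 0 := if_neg hi
    have hbj : b j = Fintype.card V := if_pos Relation.ReflTransGen.refl
    have hDi : (D i).card ≤ Fintype.card V := Finset.card_le_univ _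
    omega

theorem stmt18 (n : ℕ) (I : Finset (Fin n × Fin n))
    (hacyclic : ¬ ∃ i : Fin n, Relation.TransGen (fun p q : Fin n => (p, q) ∈ I) i i)
    (J₁ J₂ : Finset (Fin n × Fin n)) (h₁ : J₁ ⊆ I) (h₂ : J₂ ⊆ I) :
    (∀ a : Fin n → ℝ, (∀ p ∈ J₁, a p.1 > a p.2) ↔ (∀ p ∈ J₂, a p.1 > a p.2)) ↔
      (∀ i j : Fin n,
        Relation.TransGen (fun p q : Fin n => (p, q) ∈ J₁) i j ↔
          Relation.TransGen (fun p q : Fin n => (p, q) ∈ J₂) i j) := by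
  have acyclic_of_subset : ∀ J ⊆ I, ∀ i,
      ¬ Relation.TransGen (fun p q : Fin n => (p, q) ∈ J) i i := fun J hJ i hi =>
    hacyclic ⟨i, Relation.TransGen.mono (fun _ _ hpq => hJ hpq) _ _ hi⟩
  constructor
  · intro h i j
    constructor
    · intro hij
      refine transGen_of_forall_lt (acyclic_of_subset J₂ h₂) fun a ha => ?_
      exact lt_of_transGen (fun p q hpq => (h a).2 (fun e he => ha _ _ he) (p, q) hpq) hij
    · intro hij
      refine transGen_of_forall_lt (acyclic_of_subset J₁ h₁) fun a ha => ?_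
      exact lt_of_transGen (fun p q hpq => (h a).1 (fun e he => ha _ _ he) (p, q) hpq) hij
  · intro h a
    constructor
    · intro ha e he
      exact lt_of_transGen (fun p q hpq => ha (p, q) hpq) ((h e.1 e.2).2 (.single he))
    · intro ha e he
      exact lt_of_transGen (fun p q hpq => ha (p, q) hpq) ((h e.1 e.2).1 (.single he))
end

section
/- Let n be a natural number, J a finite acyclic subset of Fin n × Fin n, and (r,s) ∈ J with r ≠ s. If there is no path from r to s in J \ {(r,s)} (i.e., ¬ Relation.TransGen (fun p q ↦ (p,q) ∈ J \ {(r,s)}) r s), then there exists an assignment a : Fin n → ℝ such that a i > a j for every (i,j) ∈ J \ {(r,s)} and a r = a s; in particular, a satisfies J \ {(r,s)} but does not satisfy J. -/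
/-- An acyclic relation on a finite type admits a real labelling that strictly decreases
along it. -/
theorem exists_strict_labelling {α : Type*} [Finite α] (R : α → α → Prop)
    (hR : ∀ i, ¬ Relation.TransGen R i i) :
    ∃ b : α → ℝ, ∀ i j, R i j → b j < b i := by
  refine ⟨fun i => ((Set.ncard {k | Relation.TransGen R i k} : ℕ) : ℝ), fun i j hij => ?_⟩
  have hlt : Set.ncard {k | Relation.TransGen R j k} < Set.ncard {k | Relation.TransGen R i k} :=
    Set.ncard_lt_ncard
      ⟨fun _ hk => Relation.TransGen.head hij hk, fun h => hR j (h (.single hij))⟩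
      (Set.toFinite _)
  exact Nat.cast_lt.2 hlt

/-- A strictly decreasing labelling can be raised on the vertices that reach `r`, so as to give
`r` the same label as a higher vertex `s` that does not reach it. -/
theorem exists_strict_labelling_eq_of_le {α : Type*} (R : α → α → Prop) (b : α → ℝ)
    (hb : ∀ i j, R i j → b j < b i) {r s : α} (hsr : ¬ Relation.ReflTransGen R s r)
    (hle : b r ≤ b s) :
    ∃ a : α → ℝ, (∀ i j, R i j → a j < a i) ∧ a r = a s := by
  classical
  refine ⟨fun i => b i + if Relation.ReflTransGen R i r then b s - b r else 0,
    fun i j hij => ?_, ?_⟩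
  · have hlt := hb i j hij
    by_cases hj : Relation.ReflTransGen R j r
    · simp [hj, Relation.ReflTransGen.head hij hj, hlt]
    · by_cases hi : Relation.ReflTransGen R i r
      · simp only [hi, hj, if_true, if_false]
        linarith
      · simpa [hi, hj] using hlt
  · simp [hsr, Relation.ReflTransGen.refl]

theorem stmt19 (n : ℕ) (J : Finset (Fin n × Fin n))
    (hacyclic : ¬ ∃ i : Fin n, Relation.TransGen (fun p q : Fin n => (p, q) ∈ J) i i)
    (r s : Fin n) (hrs : (r, s) ∈ J) (hne : r ≠ s)
    (hnopath :
      ¬ Relation.TransGen (fun p q : Fin n => (p, q) ∈ J.erase (r, s)) r s) :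
    ∃ a : Fin n → ℝ,
      (∀ p ∈ J.erase (r, s), a p.1 > a p.2) ∧ a r = a s ∧
        ¬ (∀ p ∈ J, a p.1 > a p.2) := by
  set R : Fin n → Fin n → Prop := fun p q => (p, q) ∈ J.erase (r, s)
  have lift_path : ∀ {i j}, Relation.TransGen R i j →
      Relation.TransGen (fun p q : Fin n => (p, q) ∈ J) i j :=
    Relation.TransGen.mono (fun _ _ => Finset.mem_of_mem_erase) _ _
  have hrs' : ¬ Relation.ReflTransGen R r s := fun h =>
    (Relation.reflTransGen_iff_eq_or_transGen.1 h).elim (fun e => hne e.symm) hnopath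
  have hsr' : ¬ Relation.ReflTransGen R s r := fun h =>
    (Relation.reflTransGen_iff_eq_or_transGen.1 h).elim hne
      fun h => hacyclic ⟨r, .head hrs (lift_path h)⟩
  obtain ⟨b, hb⟩ := exists_strict_labelling R fun i h => hacyclic ⟨i, lift_path h⟩
  obtain ⟨a, ha, heq⟩ : ∃ a : Fin n → ℝ, (∀ i j, R i j → a j < a i) ∧ a r = a s := by
    rcases le_total (b r) (b s) with hle | hle
    · exact exists_strict_labelling_eq_of_le R b hb hsr' hle
    · obtain ⟨a, ha, heq⟩ := exists_strict_labelling_eq_of_le R b hb hrs' hle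
      exact ⟨a, ha, heq.symm⟩
  exact ⟨a, fun p hp => ha p.1 p.2 hp, heq, fun h => (h (r, s) hrs).ne' heq⟩
end
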